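/- A connected cubic graph admits a {K_3, P_4}-decomposition if and only if it has a perfect matching. -/

import Mathlib

open SimpleGraph

variable {V : Type*}

def IsTriangleOn (G : SimpleGraph V) (u v w : V) : Prop :=
  G.Adj u v ∧ G.Adj v w ∧ G.Adj u w

def triEdges [DecidableEq V] (u v w : V) : Finset (Sym2 V) :=
  {s(u, v), s(v, w), s(u, w)}

def IsTrianglePart [DecidableEq V] (G : SimpleGraph V) (P : Finset (Sym2 V)) : Prop :=
  ∃ u v w : V, IsTriangleOn G u v w ∧ P = triEdges u v w

def clawEdges [DecidableEq V] (c a b d : V) : Finset (Sym2 V) :=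
  {s(c, a), s(c, b), s(c, d)}

def IsClawPart [DecidableEq V] (G : SimpleGraph V) (P : Finset (Sym2 V)) : Prop :=
  ∃ c a b d : V, a ≠ b ∧ a ≠ d ∧ b ≠ d ∧
    G.Adj c a ∧ G.Adj c b ∧ G.Adj c d ∧ P = clawEdges c a b d

def p4Edges [DecidableEq V] (a b c d : V) : Finset (Sym2 V) :=
  {s(a, b), s(b, c), s(c, d)}

def IsP4On (G : SimpleGraph V) (a b c d : V) : Prop :=
  G.Adj a b ∧ G.Adj b c ∧ G.Adj c d ∧ a ≠ c ∧ a ≠ d ∧ b ≠ d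

def IsP4Part [DecidableEq V] (G : SimpleGraph V) (P : Finset (Sym2 V)) : Prop :=
  ∃ a b c d : V, IsP4On G a b c d ∧ P = p4Edges a b c d

/-- `D` is a partition of the edge set of `G` into parts each satisfying `allowed`. -/
def IsDecompOn [DecidableEq V] (G : SimpleGraph V)
    (allowed : Finset (Sym2 V) → Prop) (D : Finset (Finset (Sym2 V))) : Prop :=
  (∀ P ∈ D, allowed P) ∧
  (D : Set (Finset (Sym2 V))).PairwiseDisjoint id ∧
  ∀ e : Sym2 V, e ∈ G.edgeSet ↔ ∃ P ∈ D, e ∈ P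

open Finset

/-- The vertices meeting at least two edges of `P`. -/
def innerVertices [Fintype V] [DecidableEq V] (P : Finset (Sym2 V)) : Finset V :=
  {v | 1 < #{e ∈ P | v ∈ e}}

theorem mem_innerVertices [Fintype V] [DecidableEq V] {P : Finset (Sym2 V)} {v : V} :
    v ∈ innerVertices P ↔ 1 < #{e ∈ P | v ∈ e} := by
  simp [innerVertices]

theorem innerVertices_p4Edges [Fintype V] [DecidableEq V] {G : SimpleGraph V} {a b c d : V}
    (h : IsP4On G a b c d) : innerVertices (p4Edges a b c d) = {b, c} := by
  obtain ⟨hab, hbc, hcd, hac, had, hbd⟩ := h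
  have := hab.ne
  have := hbc.ne
  have := hcd.ne
  ext v
  simp only [mem_innerVertices, one_lt_card, mem_filter, p4Edges, mem_insert, mem_singleton]
  constructor
  · rintro ⟨e, ⟨he, hv⟩, f, ⟨hf, hv'⟩, hef⟩
    rcases he with rfl | rfl | rfl <;> rcases hf with rfl | rfl | rfl <;>
      simp only [Sym2.mem_iff] at hv hv' <;> grind
  · rintro (rfl | rfl)
    · exact ⟨s(a, v), by simp, s(v, c), by simp, by simp; grind⟩
    · exact ⟨s(b, v), by simp, s(v, d), by simp, by simp; grind⟩

theorem card_p4Edges [DecidableEq V] {G : SimpleGraph V} {a b c d : V}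
    (h : IsP4On G a b c d) : #(p4Edges a b c d) = 3 := by
  obtain ⟨hab, hbc, hcd, hac, had, hbd⟩ := h
  have := hab.ne
  have := hbc.ne
  have := hcd.ne
  refine card_eq_three.2 ⟨_, _, _, ?_, ?_, ?_, rfl⟩ <;> simp <;> grind

theorem innerVertices_triEdges [Fintype V] [DecidableEq V] {G : SimpleGraph V} {a b c : V}
    (h : IsTriangleOn G a b c) : innerVertices (triEdges a b c) = {a, b, c} := by
  obtain ⟨hab, hbc, hac⟩ := h
  have := hab.ne
  have := hbc.ne
  have := hac.ne
  ext v
  simp only [mem_innerVertices, one_lt_card, mem_filter, triEdges, mem_insert, mem_singleton]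
  constructor
  · rintro ⟨e, ⟨he, hv⟩, -⟩
    rcases he with rfl | rfl | rfl <;> simp only [Sym2.mem_iff] at hv <;> grind
  · rintro (rfl | rfl | rfl)
    · exact ⟨s(v, b), by simp, s(v, c), by simp, by simp; grind⟩
    · exact ⟨s(a, v), by simp, s(v, c), by simp, by simp; grind⟩
    · exact ⟨s(b, v), by simp, s(a, v), by simp, by simp; grind⟩

theorem card_triEdges [DecidableEq V] {G : SimpleGraph V} {a b c : V}
    (h : IsTriangleOn G a b c) : #(triEdges a b c) = 3 := by
  obtain ⟨hab, hbc, hac⟩ := h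
  have := hab.ne
  have := hbc.ne
  have := hac.ne
  refine card_eq_three.2 ⟨_, _, _, ?_, ?_, ?_, rfl⟩ <;> simp <;> grind

/-- A counting argument: the sets of inner vertices of the parts are disjoint, there are
`|V| / 2` parts, and each has at least two inner vertices. -/
theorem exists_isPerfectMatching_of_isDecompOn [Fintype V] [DecidableEq V] {G : SimpleGraph V}
    [DecidableRel G.Adj] (hG : G.IsRegularOfDegree 3) {D : Finset (Finset (Sym2 V))}
    (hD : IsDecompOn G (fun P => IsTrianglePart G P ∨ IsP4Part G P) D) :
    ∃ M : G.Subgraph, M.IsPerfectMatching := by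
  obtain ⟨hpart, hdisj, hcover⟩ := hD
  have hcard : ∀ P ∈ D, #P = 3 := by
    intro P hP
    rcases hpart P hP with ⟨a, b, c, h, rfl⟩ | ⟨a, b, c, d, h, rfl⟩
    exacts [card_triEdges h, card_p4Edges h]
  have hinner : ∀ P ∈ D, 2 ≤ #(innerVertices P) := by
    intro P hP
    rcases hpart P hP with ⟨a, b, c, h, rfl⟩ | ⟨a, b, c, d, h, rfl⟩
    · rw [innerVertices_triEdges h, card_eq_three.2 ⟨a, b, c, h.1.ne, h.2.2.ne, h.2.1.ne, rfl⟩]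
      norm_num
    · rw [innerVertices_p4Edges h, card_pair h.2.1.ne]
  have hinnerdisj : (D : Set (Finset (Sym2 V))).PairwiseDisjoint innerVertices := by
    intro P hP Q hQ hPQ
    rw [Function.onFun, Finset.disjoint_left]
    intro v hvP hvQ
    rw [mem_innerVertices] at hvP hvQ
    have hle : #({e ∈ P | v ∈ e} ∪ {e ∈ Q | v ∈ e}) ≤ #(G.incidenceFinset v) := by
      refine card_le_card fun e he => ?_
      rw [mem_incidenceFinset]
      simp only [mem_union, mem_filter] at he
      rcases he with he | he
      exacts [⟨(hcover e).2 ⟨P, hP, he.1⟩, he.2⟩, ⟨(hcover e).2 ⟨Q, hQ, he.1⟩, he.2⟩]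
    have hPQd : Disjoint P Q := hdisj hP hQ hPQ
    rw [card_union_of_disjoint (disjoint_filter_filter hPQd),
      card_incidenceFinset_eq_degree, hG v] at hle
    omega
  have hedges : #G.edgeFinset = #D * 3 := by
    refine Eq.trans ?_ ((card_biUnion (t := id) hdisj).trans (sum_const_nat hcard))
    congr 1
    ext e
    simp [hcover e]
  have htwice : #D * 2 = Fintype.card V := by
    have h := G.sum_degrees_eq_twice_card_edges
    rw [sum_const_nat fun v _ => hG v, card_univ] at h
    omega
  have hsum : ∑ P ∈ D, #(innerVertices P) = #(D.biUnion innerVertices) :=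
    (card_biUnion hinnerdisj).symm
  have hle : ∑ _P ∈ D, 2 ≤ ∑ P ∈ D, #(innerVertices P) := sum_le_sum hinner
  have htop := card_le_univ (D.biUnion innerVertices)
  have heq : ∑ _P ∈ D, 2 = ∑ P ∈ D, #(innerVertices P) := by
    refine hle.antisymm ?_
    rw [sum_const, smul_eq_mul]
    omega
  have htwo := (sum_eq_sum_iff_of_le hinner).1 heq
  have huniv : D.biUnion innerVertices = univ := by
    rw [← card_eq_iff_eq_univ, ← hsum, ← heq, sum_const, smul_eq_mul, htwice]
  let M : G.Subgraph :=
    { verts := Set.univ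
      Adj u v := G.Adj u v ∧ ∃ P ∈ D, innerVertices P = {u, v}
      adj_sub h := h.1
      edge_vert _ := Set.mem_univ _
      symm := ⟨fun u v ⟨h, P, hP, hPuv⟩ => ⟨h.symm, P, hP, by rw [hPuv, pair_comm]⟩⟩ }
  refine ⟨M, Subgraph.isPerfectMatching_iff.2 fun v => ?_⟩
  have hv : v ∈ D.biUnion innerVertices := huniv ▸ mem_univ v
  obtain ⟨P, hP, hvP⟩ := mem_biUnion.1 hv
  have hex : ∃ w, M.Adj v w := by
    rcases hpart P hP with ⟨a, b, c, h, rfl⟩ | ⟨a, b, c, d, h, rfl⟩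
    · have h2 := htwo _ hP
      rw [innerVertices_triEdges h,
        card_eq_three.2 ⟨a, b, c, h.1.ne, h.2.2.ne, h.2.1.ne, rfl⟩] at h2
      omega
    · have hbc := innerVertices_p4Edges h
      rw [hbc, mem_insert, mem_singleton] at hvP
      rcases hvP with rfl | rfl
      · exact ⟨c, h.2.1, _, hP, hbc⟩
      · exact ⟨b, h.2.1.symm, _, hP, by rw [hbc, pair_comm]⟩
  obtain ⟨w, hw⟩ := hex
  refine ⟨w, hw, fun w' hw' => ?_⟩
  obtain ⟨hadj, Q, hQ, hQv⟩ := hw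
  obtain ⟨hadj', Q', hQ', hQv'⟩ := hw'
  have hQQ : Q = Q' := by
    by_contra hne
    have hQQ' : Disjoint (innerVertices Q) (innerVertices Q') := hinnerdisj hQ hQ' hne
    simp [hQv, hQv'] at hQQ'
  subst hQQ
  have hmem : w' ∈ ({v, w} : Finset V) := by simp [← hQv, hQv']
  simpa [hadj'.ne'] using hmem

/-- A 2-regular graph has an orientation with all in- and outdegrees one. -/
theorem exists_orientation_of_isRegularOfDegree_two [Fintype V] [DecidableEq V]
    {H : SimpleGraph V} [DecidableRel H.Adj] (hH : H.IsRegularOfDegree 2) :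
    ∃ f : V → V, f.Injective ∧ (∀ v, H.Adj v (f v)) ∧ (Function.Injective fun v => s(v, f v)) ∧
      ∀ e ∈ H.edgeSet, ∃ v, s(v, f v) = e := by
  have hall : ∀ S : Finset V, #S ≤ #(S.biUnion fun v => H.incidenceFinset v) := by
    intro S
    refine Nat.le_of_mul_le_mul_right
      (card_mul_le_card_mul (fun (v : V) (e : Sym2 V) => v ∈ e) (m := 2) (n := 2) ?_ ?_) two_pos
    · intro v hv
      rw [← hH v, ← card_incidenceFinset_eq_degree]
      refine card_le_card fun e he => ?_
      rw [mem_bipartiteAbove, mem_biUnion]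
      exact ⟨⟨v, hv, he⟩, ((H.mem_incidenceFinset v e).1 he).2⟩
    · intro e _
      induction e with
      | _ a b =>
        refine (card_le_card fun v hv => ?_).trans (card_le_two (a := a) (b := b))
        simpa using ((mem_bipartiteBelow _).1 hv).2
  obtain ⟨g, hg, hinc⟩ :=
    (all_card_le_biUnion_card_iff_exists_injective fun v => H.incidenceFinset v).1 hall
  have hinc' : ∀ v, g v ∈ H.incidenceSet v := fun v => (H.mem_incidenceFinset v _).1 (hinc v)
  have hex : ∀ v, ∃ w, s(v, w) = g v := fun v => by
    obtain ⟨w, hw⟩ := Sym2.mem_iff_exists.1 (hinc' v).2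
    exact ⟨w, hw.symm⟩
  choose f hf using hex
  have hadj : ∀ v, H.Adj v (f v) := fun v => by
    have h := (hinc' v).1
    rwa [← hf v, mem_edgeSet] at h
  have hgf : (fun v => s(v, f v)) = g := funext hf
  refine ⟨f, fun u v huv => ?_, hadj, hgf ▸ hg, fun e he => ?_⟩
  · by_contra hne
    have hsub : {u, v} ⊆ H.neighborFinset (f u) := by
      intro x hx
      rw [mem_neighborFinset]
      rcases mem_insert.1 hx with rfl | hx
      · exact (hadj x).symm
      · rw [mem_singleton.1 hx, huv]
        exact (hadj v).symm
    have heq := eq_of_subset_of_card_le hsub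
      (by rw [card_neighborFinset_eq_degree, hH, card_pair hne])
    have hmem : f (f u) ∈ ({u, v} : Finset V) := by
      rw [heq, mem_neighborFinset]
      exact hadj _
    rcases mem_insert.1 hmem with h | h
    · exact (hadj u).ne (hg (by rw [← hf u, ← hf (f u), h, Sym2.eq_swap]))
    · exact (hadj v).ne (hg (by rw [← hf v, ← hf (f v), ← huv, mem_singleton.1 h, Sym2.eq_swap]))
  · have hcard : #H.edgeFinset = #(univ.image g) := by
      have h := H.sum_degrees_eq_twice_card_edges
      rw [sum_const_nat fun v _ => hH v] at h
      rw [card_image_of_injective _ hg]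
      omega
    have himage : univ.image g = H.edgeFinset := by
      refine eq_of_subset_of_card_le (fun x hx => ?_) hcard.le
      obtain ⟨v, -, rfl⟩ := mem_image.1 hx
      exact mem_edgeFinset.2 (hinc' v).1
    obtain ⟨v, -, hv⟩ := mem_image.1 (himage ▸ mem_edgeFinset.2 he)
    exact ⟨v, (hf v).trans hv⟩

/-- Orient the 2-regular graph `G - M`; each edge of `M` together with the edges leaving its
two ends is a path. -/
theorem exists_isDecompOn_of_isPerfectMatching [Fintype V] [DecidableEq V] {G : SimpleGraph V}
    [DecidableRel G.Adj] (hG : G.IsRegularOfDegree 3) {M : G.Subgraph}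
    (hM : M.IsPerfectMatching) :
    ∃ D : Finset (Finset (Sym2 V)), IsDecompOn G (IsP4Part G) D := by
  classical
  choose m hm huniq using Subgraph.isPerfectMatching_iff.1 hM
  have hmm : ∀ v, m (m v) = v := fun v => (huniq (m v) v (hm v).symm).symm
  have hadj_m : ∀ v, G.Adj v (m v) := fun v => (hm v).adj_sub
  have hH : (G \ M.spanningCoe).IsRegularOfDegree 2 := by
    intro v
    have h : (G \ M.spanningCoe).neighborFinset v = (G.neighborFinset v).erase (m v) := by
      ext w
      simp only [mem_neighborFinset, sdiff_adj, Subgraph.spanningCoe_adj, mem_erase]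
      have : M.Adj v w ↔ w = m v := ⟨huniq v w, fun h => h ▸ hm v⟩
      tauto
    rw [← card_neighborFinset_eq_degree, h, card_erase_of_mem (by simpa using hadj_m v),
      card_neighborFinset_eq_degree, hG v]
  obtain ⟨f, hinj, hadj, hedge, hsurj⟩ := exists_orientation_of_isRegularOfDegree_two hH
  have hadj_f : ∀ v, G.Adj v (f v) := fun v => (hadj v).1
  have hne : ∀ v, f v ≠ m v := fun v h => (hadj v).2 (h ▸ hm v)
  have hcross : ∀ u v, s(u, m u) ≠ s(v, f v) := by
    intro u v h
    rcases Sym2.eq_iff.1 h with ⟨h, h'⟩ | ⟨h, h'⟩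
    · exact hne v (by rw [← h', h])
    · exact hne v (by rw [← h, ← h', hmm])
  have hmatch : ∀ u v, s(u, m u) = s(v, m v) → u = v ∨ u = m v := by
    intro u v h
    rcases Sym2.eq_iff.1 h with h | h
    exacts [.inl h.1, .inr h.1]
  have hmem : ∀ e v, e ∈ p4Edges (f v) v (m v) (f (m v)) ↔
      e = s(v, f v) ∨ e = s(v, m v) ∨ e = s(m v, f (m v)) := by
    intro e v
    simp only [p4Edges, mem_insert, mem_singleton, Sym2.eq_swap (a := f v) (b := v)]
  have hpartner : ∀ v, p4Edges (f (m v)) (m v) (m (m v)) (f (m (m v))) =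
      p4Edges (f v) v (m v) (f (m v)) := by
    intro v
    ext e
    rw [hmem, hmem, hmm, Sym2.eq_swap (a := m v) (b := v)]
    tauto
  refine ⟨univ.image fun v => p4Edges (f v) v (m v) (f (m v)), ?_, ?_, fun e => ?_⟩
  · intro P hP
    obtain ⟨v, -, rfl⟩ := mem_image.1 hP
    refine ⟨_, _, _, _, ⟨(hadj_f v).symm, hadj_m v, hadj_f _, hne v, ?_, ?_⟩, rfl⟩
    · exact fun h => (hadj_m v).ne (hinj h)
    · exact fun h => hne (m v) (by rw [hmm, ← h])
  · intro P hP Q hQ hPQ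
    obtain ⟨u, -, rfl⟩ := mem_image.1 hP
    obtain ⟨v, -, rfl⟩ := mem_image.1 hQ
    refine Finset.disjoint_left.2 fun e hu hv => hPQ ?_
    suffices u = v ∨ u = m v by
      rcases this with rfl | rfl
      exacts [rfl, hpartner v]
    have key : ∀ x y, s(x, f x) = s(y, f y) → x = y := fun x y h => hedge h
    simp only [id] at hu hv
    rw [hmem] at hu hv
    rcases hu with rfl | rfl | rfl <;> rcases hv with h | h | h <;> grind
  · constructor
    · intro he
      by_cases heM : e ∈ M.edgeSet
      · induction e with
        | _ a b =>
          refine ⟨_, mem_image_of_mem _ (mem_univ a), (hmem _ _).2 (.inr (.inl ?_))⟩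
          rw [huniq a b heM]
      · obtain ⟨v, rfl⟩ := hsurj e (by
          induction e with
          | _ a b => exact ⟨he, heM⟩)
        exact ⟨_, mem_image_of_mem _ (mem_univ v), (hmem _ _).2 (.inl rfl)⟩
    · rintro ⟨P, hP, heP⟩
      obtain ⟨v, -, rfl⟩ := mem_image.1 hP
      rcases (hmem _ _).1 heP with rfl | rfl | rfl
      exacts [hadj_f v, hadj_m v, hadj_f _]

/-- A connected cubic graph admits a {K₃, P₄}-decomposition iff it has a
perfect matching. -/
theorem stmt_2 [Fintype V] [DecidableEq V] (G : SimpleGraph V)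
    (hconn : G.Connected) (hcubic : ∀ v : V, (G.neighborSet v).ncard = 3) :
    (∃ D : Finset (Finset (Sym2 V)),
        IsDecompOn G (fun P => IsTrianglePart G P ∨ IsP4Part G P) D) ↔
      ∃ M : G.Subgraph, M.IsPerfectMatching := by
  classical
  have hG : G.IsRegularOfDegree 3 := fun v => by
    rw [← hcubic v, Set.ncard_eq_toFinset_card', ← card_neighborFinset_eq_degree]
    rfl
  constructor
  · rintro ⟨D, hD⟩
    exact exists_isPerfectMatching_of_isDecompOn hG hD
  · rintro ⟨M, hM⟩
    obtain ⟨D, hpart, hrest⟩ := exists_isDecompOn_of_isPerfectMatching hG hM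
    exact ⟨D, fun P hP => .inr (hpart P hP), hrest⟩
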